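/- arXiv:2510.23454 — 3 statements merged into one kernel-verified Lean document; each statement's English description precedes it below -/
import Mathlib

section
/- Let K ∈ ℕ and let ℓ, V, V* : ℕ → ℝ be real sequences satisfying: (i) ℓ(n) ≥ 0 for all n < K; (ii) ℓ(n) ≤ V*(n) − V(n+1) for all n < K (cost decrease along a feasible shifted solution); (iii) V*(n) ≤ V(n) for all n ≤ K (optimality); (iv) V*(n+1) ≤ V*(n) for all n < K (descent condition); (v) V(K) ≥ 0 and V*(K) ≥ 0 (nonnegativity of the costs at the final time). Then the accumulated stage cost satisfies ∑_{n=0}^{K−1} ℓ(n) ≤ 2·V(0). -/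
/-- The accumulated stage cost of the MOMPC closed loop is bounded by
twice the cost of the initial feasible solution. -/
theorem stmt_1 (K : ℕ) (ℓ V Vstar : ℕ → ℝ)
    (h_nonneg : ∀ n < K, 0 ≤ ℓ n)
    (h_decrease : ∀ n < K, ℓ n ≤ Vstar n - V (n + 1))
    (h_opt : ∀ n ≤ K, Vstar n ≤ V n)
    (h_descent : ∀ n < K, Vstar (n + 1) ≤ Vstar n)
    (hVK : 0 ≤ V K) (hVsK : 0 ≤ Vstar K) :
    ∑ n ∈ Finset.range K, ℓ n ≤ 2 * V 0 := by
  have h_sum_nonneg : 0 ≤ ∑ n ∈ Finset.range K, ℓ n :=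
    Finset.sum_nonneg fun n hn => h_nonneg n (Finset.mem_range.mp hn)
  have h_telescope : ∑ n ∈ Finset.range K, ℓ n ≤ V 0 - V K := by
    rw [← Finset.sum_range_sub' V K]
    refine Finset.sum_le_sum fun n hn => ?_
    have hnK := Finset.mem_range.mp hn
    linarith [h_decrease n hnK, h_opt n hnK.le]
  linarith
end

section
/- Let S and U be types, f : S → U → S a dynamics map, X_T ⊆ S a terminal set, κ : S → U a local feedback with f(ξ, κ(ξ)) ∈ X_T for all ξ ∈ X_T, and let ℓ : S → U → ℝ (stage cost) and F : S → ℝ (terminal cost) satisfy the Lyapunov-function terminal-cost condition: F(f(ξ, κ(ξ))) + ℓ(ξ, κ(ξ)) ≤ F(ξ) for all ξ ∈ X_T. Let N ≥ 1 and let x_0,…,x_N ∈ S and u_0,…,u_{N−1} ∈ U satisfy x_{j+1} = f(x_j,u_j) for j = 0,…,N−1 and x_N ∈ X_T. Define the shifted trajectory x'_j := x_{j+1} for j = 0,…,N−1, x'_N := f(x_N, κ(x_N)), u'_j := u_{j+1} for j = 0,…,N−2, u'_{N−1} := κ(x_N), and the horizon-N cost J(x,u) := ∑_{j=0}^{N−1}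 ℓ(x_j,u_j) + F(x_N). Then J(x',u') ≤ J(x,u) − ℓ(x_0,u_0). -/
/-- Under the Lyapunov-function terminal-cost condition, the cost of the
shifted trajectory decreases by at least the first stage cost. -/
theorem stmt_5 {S U : Type*} (f : S → U → S)
    (XT : Set S) (κ : S → U)
    (hκinv : ∀ ξ ∈ XT, f ξ (κ ξ) ∈ XT)
    (ℓ : S → U → ℝ) (F : S → ℝ)
    (hLyap : ∀ ξ ∈ XT, F (f ξ (κ ξ)) + ℓ ξ (κ ξ) ≤ F ξ)
    (N : ℕ) (hN : 1 ≤ N)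
    (x : ℕ → S) (u : ℕ → U)
    (hdyn : ∀ j < N, x (j + 1) = f (x j) (u j))
    (hterm : x N ∈ XT)
    (x' : ℕ → S) (u' : ℕ → U)
    (hx'def : ∀ j < N, x' j = x (j + 1))
    (hx'N : x' N = f (x N) (κ (x N)))
    (hu'def : ∀ j, j + 1 < N → u' j = u (j + 1))
    (hu'N : u' (N - 1) = κ (x N)) :
    (∑ j ∈ Finset.range N, ℓ (x' j) (u' j)) + F (x' N) ≤
      ((∑ j ∈ Finset.range N, ℓ (x j) (u j)) + F (x N)) - ℓ (x 0) (u 0) := by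
  obtain ⟨M, rfl⟩ : ∃ M, N = M + 1 := ⟨N - 1, by omega⟩
  have hshift : ∑ j ∈ Finset.range M, ℓ (x' j) (u' j) =
      ∑ j ∈ Finset.range M, ℓ (x (j + 1)) (u (j + 1)) := by
    refine Finset.sum_congr rfl fun j hj => ?_
    have hjM := Finset.mem_range.mp hj
    rw [hx'def j (by omega), hu'def j (by omega)]
  have hlast : u' M = κ (x (M + 1)) := hu'N
  rw [Finset.sum_range_succ, Finset.sum_range_succ' (fun j => ℓ (x j) (u j)), hshift,
    hx'def M (by omega), hlast, hx'N]
  linarith [hLyap _ hterm]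
end

section
/- Let n ≥ 1, let 𝕏 be a type with a feasible set S ⊆ 𝕏, and let J : 𝕏 → ℝⁿ be a vector of n objective functions. Let a ∈ ℝⁿ (the shooting origin) and d ∈ ℝⁿ with d_i < 0 for all i (the shooting direction, e.g. a quasi-normal pointing toward the utopia point). Consider the Pascoletti–Serafini scalarized problem with ordering cone ℝ≥0ⁿ: minimize −l over pairs (x, l) ∈ S × ℝ subject to a_i + l·d_i − J_i(x) ≥ 0 for all i. If (x*, l*) is an optimal solution of this problem, then x* is weakly Pareto optimal, i.e. there is no x ∈ S with J_i(x) < J_i(x*) for all i. -/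
/-- An optimal solution of the Pascoletti–Serafini scalarization with
ordering cone `ℝ≥0ⁿ` and strictly negative shooting direction is weakly Pareto
optimal. -/
theorem stmt_13 {𝕏 : Type*} (n : ℕ) (hn : 1 ≤ n)
    (S : Set 𝕏) (J : 𝕏 → Fin n → ℝ)
    (a d : Fin n → ℝ) (hd : ∀ i, d i < 0)
    (xstar : 𝕏) (lstar : ℝ)
    (hxS : xstar ∈ S)
    (hfeas : ∀ i, 0 ≤ a i + lstar * d i - J xstar i)
    (hopt : ∀ x ∈ S, ∀ l : ℝ, (∀ i, 0 ≤ a i + l * d i - J x i) → -lstar ≤ -l) :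
    ¬∃ x ∈ S, ∀ i, J x i < J xstar i := by
  rintro ⟨x, hx, hlt⟩
  have : Nonempty (Fin n) := ⟨⟨0, hn⟩⟩
  obtain ⟨k, hk⟩ := Finite.exists_min fun i => (J x i - a i) / d i
  have hle : -lstar ≤ -((J x k - a k) / d k) := by
    refine hopt x hx _ fun i => ?_
    have := (le_div_iff_of_neg (hd i)).1 (hk i)
    linarith
  have hgt : lstar < (J x k - a k) / d k := by
    rw [lt_div_iff_of_neg (hd k)]
    linarith [hlt k, hfeas k]
  linarith
end
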